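/- arXiv:1007.5422 — 7 statements merged into one kernel-verified Lean document; each statement's English description precedes it below -/
import Mathlib

section
/- Let S be a finite type (system qubits) and B a finite type (bath qubits). For each l ∈ S let 𝓘_l be a finite set of subsets I ⊆ B, with a phase φ(l,I) ∈ ℝ for each such I. Fix a subset M ⊆ B with cardinality m such that (a) M ⊆ I for every l ∈ S and every I ∈ 𝓘_l, and (b) for l ≠ l', I ∈ 𝓘_l and I' ∈ 𝓘_{l'} imply I ∩ I' = M. Let U be the diagonal unitary on the index type (S → Fin 2) × (B → Fin 2) whose diagonal entry at (s,k) is exp(i·Σ_{l∈S} Σ_{I∈𝓘_l} φ(l,I)·(s l)·Π_{i∈I}(k i)) (bits regarded as 0/1 reals), and define the completely positive map E(ρ) = tr_B( U (ρ ⊗ Q_B) Uᴴ ) on matrices ρ indexed by (S → Fin 2). Then 2^{|B|}·E(ρ) = (2^{|B|} − 2^{|B|−m})·ρ + Σ_{k' : (B\M) → Fin 2} W̃_{k'} ρ W̃_{k'}ᴴ, where W̃_{k'} is the tensor product of single-qubit phase gates given entrywise by W̃_{k'}(s,s') = Π_{l∈S} ( u(β̃_l(k')) )_{s l, s' l} with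 β̃_l(k') = Σ_{I∈𝓘_l} φ(l,I)·Π_{i∈I\M}(k' i). In particular, each Kraus operator of E is a tensor product of single-qubit phase gates. -/
open Matrix
open scoped Kronecker

noncomputable section

/-- The single-qubit phase gate `u(θ) = diag(1, e^{iθ})`. -/
def phaseGate (θ : ℝ) : Matrix (Fin 2) (Fin 2) ℂ :=
  Matrix.diagonal fun j => if j = 1 then Complex.exp (Complex.I * (θ : ℂ)) else 1

/-- A product of single-qubit phase gates, taken entrywise, is a diagonal matrix. -/
lemma phaseGate_prod_eq_diagonal {S : Type*} [Fintype S] [DecidableEq S] (θ : S → ℝ) :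
    (Matrix.of fun s s' : S → Fin 2 => ∏ l, phaseGate (θ l) (s l) (s' l)) =
      Matrix.diagonal fun s =>
        Complex.exp (Complex.I * ((∑ l, ((s l : ℕ) : ℝ) * θ l : ℝ) : ℂ)) := by
  ext s s'
  rw [Matrix.of_apply]
  by_cases h : s = s'
  · subst h
    rw [Matrix.diagonal_apply_eq, Complex.ofReal_sum, Finset.mul_sum, Complex.exp_sum]
    refine Finset.prod_congr rfl fun l _ => ?_
    rw [phaseGate, Matrix.diagonal_apply_eq]
    generalize s l = j
    fin_cases j <;> simp
  · obtain ⟨l, hl⟩ := Function.ne_iff.mp h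
    rw [Matrix.diagonal_apply_ne _ h]
    exact Finset.prod_eq_zero (Finset.mem_univ l) (Matrix.diagonal_apply_ne _ hl)

/-- A product of bits over `M` is `1` if all bits in `M` are set, and `0` otherwise. -/
lemma prod_bits_eq_ite {B : Type*} [DecidableEq B] (M : Finset B) (b : B → Fin 2) :
    ∏ i ∈ M, ((b i : ℕ) : ℝ) =
      if (fun i : { i : B // i ∈ M } => b i) = 1 then 1 else 0 := by
  split_ifs with h
  · refine Finset.prod_eq_one fun i hi => ?_
    have hbi : b i = 1 := congrFun h ⟨i, hi⟩
    simp [hbi]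
  · obtain ⟨⟨i, hi⟩, hne⟩ := Function.ne_iff.mp h
    refine Finset.prod_eq_zero hi ?_
    have hbi : b i = 0 := by
      have hne' : b i ≠ 1 := hne
      omega
    simp [hbi]

/-- Summing over all bit strings a function that is `1` unless all bits in `M` are set, in
which case it depends on the remaining bits only. -/
lemma sum_ite_bits_eq {B : Type*} [Fintype B] [DecidableEq B] (M : Finset B)
    (g : ({ i : B // i ∉ M } → Fin 2) → ℂ) :
    ∑ b : B → Fin 2, (if (fun i : { i : B // i ∈ M } => b i) = 1
        then g (fun i => b i) else 1) =
      ((2 : ℂ) ^ Fintype.card B - (2 : ℂ) ^ (Fintype.card B - M.card)) + ∑ k, g k := by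
  have hcard : Fintype.card { i : B // i ∉ M } = Fintype.card B - M.card := by
    rw [Fintype.card_subtype_compl, Fintype.card_coe]
  have hpow : (2 : ℂ) ^ Fintype.card B = 2 ^ (Fintype.card B - M.card) * 2 ^ M.card := by
    rw [← pow_add, Nat.sub_add_cancel (Finset.card_le_univ M)]
  have hreindex := Equiv.sum_comp (Equiv.piEquivPiSubtypeProd (fun i => i ∈ M) fun _ => Fin 2)
    fun p => if p.1 = 1 then g p.2 else 1
  refine hreindex.trans ?_
  have hsplit (p : ({ i : B // i ∈ M } → Fin 2) × ({ i : B // i ∉ M } → Fin 2)) :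
      (if p.1 = 1 then g p.2 else 1) = 1 + if p.1 = 1 then g p.2 - 1 else 0 := by
    split_ifs <;> ring
  simp_rw [hsplit]
  rw [Fintype.sum_prod_type_right]
  simp only [Finset.sum_add_distrib, Finset.sum_ite_eq', Finset.mem_univ, if_true,
    Finset.sum_sub_distrib, Finset.sum_const, Finset.card_univ, Fintype.card_fun,
    Fintype.card_fin, Fintype.card_coe, hcard, nsmul_eq_mul, Nat.cast_pow, Nat.cast_ofNat,
    mul_one, hpow]
  ring

/-- Purely dephasing map with `m` common bath qubits: if a fixed set `M`
of `m` bath qubits is contained in every interaction set and is exactly the pairwise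
overlap of interaction sets belonging to different system qubits, then
`2^{|B|} E(ρ) = (2^{|B|} - 2^{|B|-m}) ρ + Σ_{k' : (B∖M) → Fin 2} W̃_{k'} ρ W̃_{k'}ᴴ`,
where each `W̃_{k'}` is a tensor product of single-qubit phase gates `u(β̃_l(k'))`. -/
theorem purely_dephasing_map_common_bath
    {S B : Type*} [Fintype S] [DecidableEq S] [Fintype B] [DecidableEq B]
    (𝓘 : S → Finset (Finset B)) (φ : S → Finset B → ℝ)
    (M : Finset B)
    (ha : ∀ l, ∀ J ∈ 𝓘 l, M ⊆ J)
    (hb : ∀ l l', l ≠ l' → ∀ J ∈ 𝓘 l, ∀ J' ∈ 𝓘 l', J ∩ J' = M)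
    (U : Matrix ((S → Fin 2) × (B → Fin 2)) ((S → Fin 2) × (B → Fin 2)) ℂ)
    (hU : U = Matrix.diagonal fun p =>
      Complex.exp (Complex.I *
        ((∑ l, ∑ J ∈ 𝓘 l, φ l J * ((p.1 l : ℕ) : ℝ) * ∏ i ∈ J, ((p.2 i : ℕ) : ℝ) : ℝ) : ℂ)))
    (Q : Matrix (B → Fin 2) (B → Fin 2) ℂ)
    (hQ : Q = Matrix.of fun _ _ => ((2 : ℂ) ^ Fintype.card B)⁻¹)
    (E : Matrix (S → Fin 2) (S → Fin 2) ℂ → Matrix (S → Fin 2) (S → Fin 2) ℂ)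
    (hE : ∀ ρ, E ρ = Matrix.of fun s s' =>
      ∑ b : B → Fin 2, (U * (ρ ⊗ₖ Q) * Uᴴ) (s, b) (s', b))
    (βt : S → ({ i : B // i ∉ M } → Fin 2) → ℝ)
    (hβt : ∀ l k', βt l k' = ∑ J ∈ 𝓘 l, φ l J *
      ∏ i ∈ J \ M, (if h : i ∈ M then (1 : ℝ) else ((k' ⟨i, h⟩ : ℕ) : ℝ)))
    (Wt : ({ i : B // i ∉ M } → Fin 2) → Matrix (S → Fin 2) (S → Fin 2) ℂ)
    (hWt : ∀ k', Wt k' = Matrix.of fun s s' => ∏ l, (phaseGate (βt l k')) (s l) (s' l)) :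
    ∀ ρ : Matrix (S → Fin 2) (S → Fin 2) ℂ,
      ((2 : ℂ) ^ Fintype.card B) • E ρ =
        ((2 : ℂ) ^ Fintype.card B - (2 : ℂ) ^ (Fintype.card B - M.card)) • ρ +
          ∑ k' : { i : B // i ∉ M } → Fin 2, Wt k' * ρ * (Wt k')ᴴ := by
  intro ρ
  have hphase (s : S → Fin 2) (b : B → Fin 2) :
      (∑ l, ∑ J ∈ 𝓘 l, φ l J * ((s l : ℕ) : ℝ) * ∏ i ∈ J, ((b i : ℕ) : ℝ)) =
        (∏ i ∈ M, ((b i : ℕ) : ℝ)) * ∑ l, ((s l : ℕ) : ℝ) * βt l (fun i => b i) := by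
    rw [Finset.mul_sum]
    refine Finset.sum_congr rfl fun l _ => ?_
    rw [hβt, Finset.mul_sum, Finset.mul_sum]
    refine Finset.sum_congr rfl fun J hJ => ?_
    have hrest : ∏ i ∈ J \ M, (if h : i ∈ M then (1 : ℝ) else ((b i : ℕ) : ℝ)) =
        ∏ i ∈ J \ M, ((b i : ℕ) : ℝ) :=
      Finset.prod_congr rfl fun i hi => dif_neg (Finset.mem_sdiff.mp hi).2
    rw [hrest, ← Finset.prod_sdiff (ha l J hJ)]
    ring
  set D : (S → Fin 2) → ({ i : B // i ∉ M } → Fin 2) → ℂ := fun s k =>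
    Complex.exp (Complex.I * ((∑ l, ((s l : ℕ) : ℝ) * βt l k : ℝ) : ℂ)) with hD
  have hW (k) : Wt k = Matrix.diagonal fun s => D s k := by
    rw [hWt, phaseGate_prod_eq_diagonal]
  have hUD : U = Matrix.diagonal fun p =>
      if (fun i : { i : B // i ∈ M } => p.2 i) = 1 then D p.1 (fun i => p.2 i) else 1 := by
    rw [hU]
    congr 1
    funext p
    rw [hphase, prod_bits_eq_ite]
    split_ifs <;> simp [hD]
  ext s s'
  have hentry (b : B → Fin 2) : (U * (ρ ⊗ₖ Q) * Uᴴ) (s, b) (s', b) =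
      ((2 : ℂ) ^ Fintype.card B)⁻¹ * ρ s s' *
        if (fun i : { i : B // i ∈ M } => b i) = 1
          then D s (fun i => b i) * star (D s' fun i => b i) else 1 := by
    rw [hUD, hQ, Matrix.diagonal_conjTranspose, Matrix.mul_diagonal, Matrix.diagonal_mul,
      Matrix.kroneckerMap_apply, Matrix.of_apply, Pi.star_apply]
    dsimp only
    split_ifs
    · ring
    · rw [star_one]
      ring
  have hK (k) : (Wt k * ρ * (Wt k)ᴴ) s s' = ρ s s' * (D s k * star (D s' k)) := by
    rw [hW, Matrix.diagonal_conjTranspose, Matrix.mul_diagonal, Matrix.diagonal_mul,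
      Pi.star_apply]
    ring
  rw [Matrix.smul_apply, hE, Matrix.of_apply, Matrix.add_apply, Matrix.smul_apply,
    Matrix.sum_apply]
  simp_rw [hentry, hK]
  rw [← Finset.mul_sum, ← Finset.mul_sum,
    sum_ite_bits_eq M fun k => D s k * star (D s' k), smul_eq_mul, smul_eq_mul, mul_assoc,
    mul_inv_cancel_left₀ (pow_ne_zero _ two_ne_zero)]
  ring

end
end

section
/- Let B be a finite type (bath qubits), let S_1,…,S_L be pairwise disjoint nonempty subsets of B, and let φ_1,…,φ_L ∈ ℝ. Define the state ψ : Fin 2 × (B → Fin 2) → ℂ of one system qubit and the bath by ψ(a,y) = 2^{−(1+|B|)/2}·exp(i·(a : ℝ)·Σ_{l=1}^{L} φ_l·Π_{j∈S_l}(y j)) (bits regarded as 0/1 reals). Let ρ₁(a,b) = Σ_{y : B → Fin 2} ψ(a,y)·conj(ψ(b,y)) be the reduced state of the system qubit. Then ρ₁ = (1/2)·[[1, Π_{l=1}^{L}(1 − (1−e^{−iφ_l})·2^{−|S_l|})], [Π_{l=1}^{L}(1 − (1−e^{iφ_l})·2^{−|S_l|}), 1]]. That is, if a single system qubit interacts with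 the bath through L pure phase gates on pairwise disjoint sets of bath qubits, the coherence is multiplied by Π_l 2^{−(k_l−1)}(2^{k_l−1}−1+e^{−iφ_l}) where k_l−1 = |S_l|. -/
open Matrix

/-- The mean of a product of bits over all bit strings factors over the coordinates. -/
theorem sum_prod_bits {B : Type*} [Fintype B] [DecidableEq B] (U : Finset B) :
    ∑ y : B → Fin 2, ∏ j ∈ U, (((y j : Fin 2) : ℕ) : ℂ) =
      2 ^ Fintype.card B * ((2 : ℂ) ^ U.card)⁻¹ := by
  have hprod (y : B → Fin 2) : ∏ j ∈ U, (((y j : Fin 2) : ℕ) : ℂ) =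
      ∏ j, (if j ∈ U then (((y j : Fin 2) : ℕ) : ℂ) else 1) := by
    simp
  have hcoord (j : B) : ∑ v : Fin 2, (if j ∈ U then (((v : Fin 2) : ℕ) : ℂ) else 1) =
      2 * (if j ∈ U then (2 : ℂ)⁻¹ else 1) := by
    by_cases h : j ∈ U <;> simp [h]
  simp_rw [hprod]
  rw [← Fintype.prod_sum (fun j (v : Fin 2) => if j ∈ U then (((v : Fin 2) : ℕ) : ℂ) else 1)]
  simp_rw [hcoord]
  rw [Finset.prod_mul_distrib]
  simp

/-- The bits in pairwise disjoint blocks are independent under the uniform distribution. -/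
theorem sum_prod_one_add_mul_bits {B ι : Type*} [Fintype B] [DecidableEq B] [Fintype ι]
    [DecidableEq ι] (S : ι → Finset B) (hdisj : ∀ l l', l ≠ l' → Disjoint (S l) (S l'))
    (c : ι → ℂ) :
    ∑ y : B → Fin 2, ∏ l, (1 + c l * ∏ j ∈ S l, (((y j : Fin 2) : ℕ) : ℂ)) =
      2 ^ Fintype.card B * ∏ l, (1 + c l * ((2 : ℂ) ^ (S l).card)⁻¹) := by
  simp_rw [Finset.prod_one_add]
  rw [Finset.sum_comm, Finset.mul_sum]
  refine Finset.sum_congr rfl fun t _ => ?_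
  have ht : (t : Set ι).PairwiseDisjoint S := fun l _ l' _ h => hdisj l l' h
  simp_rw [Finset.prod_mul_distrib, ← Finset.prod_biUnion ht]
  rw [← Finset.mul_sum, sum_prod_bits, Finset.card_biUnion fun l _ l' _ h => hdisj l l' h,
    ← Finset.prod_pow_eq_pow_sum, Finset.prod_inv_distrib]
  ring

theorem exp_mul_prod_bits {B : Type*} (U : Finset B) (y : B → Fin 2) (z : ℂ) :
    Complex.exp (z * ∏ j ∈ U, (((y j : Fin 2) : ℕ) : ℂ)) =
      1 + (Complex.exp z - 1) * ∏ j ∈ U, (((y j : Fin 2) : ℕ) : ℂ) := by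
  by_cases h : ∃ j ∈ U, y j = 0
  · obtain ⟨j, hj, hy⟩ := h
    rw [Finset.prod_eq_zero hj (by simp [hy])]
    simp
  · push Not at h
    rw [Finset.prod_eq_one fun j hj => by rw [Fin.eq_one_of_ne_zero _ (h j hj)]; simp]
    simp

theorem sum_exp_disjoint_phases {B ι : Type*} [Fintype B] [DecidableEq B] [Fintype ι]
    [DecidableEq ι] (S : ι → Finset B) (hdisj : ∀ l l', l ≠ l' → Disjoint (S l) (S l'))
    (z : ι → ℂ) :
    ∑ y : B → Fin 2, Complex.exp (∑ l, z l * ∏ j ∈ S l, (((y j : Fin 2) : ℕ) : ℂ)) =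
      2 ^ Fintype.card B *
        ∏ l, (1 - (1 - Complex.exp (z l)) * ((2 : ℂ) ^ (S l).card)⁻¹) := by
  simp_rw [Complex.exp_sum, exp_mul_prod_bits]
  rw [sum_prod_one_add_mul_bits S hdisj]
  congr 1
  refine Finset.prod_congr rfl fun l _ => ?_
  ring

/-- A single system qubit interacting with the bath through `L` pure
phase gates on pairwise disjoint nonempty sets `S l` of bath qubits: the reduced state of
the system qubit is
`(1/2)·[[1, Π_l (1-(1-e^{-iφ_l})2^{-|S_l|})], [Π_l (1-(1-e^{iφ_l})2^{-|S_l|}), 1]]`. -/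
theorem reduced_state_disjoint_phase_gates
    {B : Type*} [Fintype B] [DecidableEq B] (L : ℕ)
    (S : Fin L → Finset B)
    (hdisj : ∀ l l', l ≠ l' → Disjoint (S l) (S l'))
    (hne : ∀ l, (S l).Nonempty)
    (φ : Fin L → ℝ)
    (ψ : Fin 2 × (B → Fin 2) → ℂ)
    (hψ : ψ = fun p =>
      (((Real.sqrt (2 ^ (1 + Fintype.card B)))⁻¹ : ℝ) : ℂ) *
        Complex.exp (Complex.I *
          ((((p.1 : ℕ) : ℝ) * ∑ l, φ l * ∏ j ∈ S l, ((p.2 j : ℕ) : ℝ) : ℝ) : ℂ)))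
    (ρ₁ : Matrix (Fin 2) (Fin 2) ℂ)
    (hρ : ρ₁ = Matrix.of fun a b =>
      ∑ y : B → Fin 2, ψ (a, y) * (starRingEnd ℂ) (ψ (b, y))) :
    ρ₁ = (2 : ℂ)⁻¹ •
      !![1, ∏ l, (1 - (1 - Complex.exp (-(Complex.I * (φ l : ℂ)))) * ((2 : ℂ) ^ ((S l).card))⁻¹);
         ∏ l, (1 - (1 - Complex.exp (Complex.I * (φ l : ℂ))) * ((2 : ℂ) ^ ((S l).card))⁻¹), 1] := by
  have hnorm : (((Real.sqrt (2 ^ (1 + Fintype.card B)))⁻¹ : ℝ) : ℂ) *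
      (((Real.sqrt (2 ^ (1 + Fintype.card B)))⁻¹ : ℝ) : ℂ) =
        (2 : ℂ)⁻¹ * (2 ^ Fintype.card B)⁻¹ := by
    rw [← Complex.ofReal_mul, ← mul_inv, Real.mul_self_sqrt (by positivity), pow_add]
    push_cast
    rw [pow_one, mul_inv]
  have hentry (a b : Fin 2) : ρ₁ a b = (2 : ℂ)⁻¹ *
      ∏ l, (1 - (1 - Complex.exp (Complex.I * (((a : ℕ) : ℂ) - ((b : ℕ) : ℂ)) * (φ l : ℂ))) *
        ((2 : ℂ) ^ (S l).card)⁻¹) := by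
    have hterm (y : B → Fin 2) : ψ (a, y) * (starRingEnd ℂ) (ψ (b, y)) =
        (2 : ℂ)⁻¹ * (2 ^ Fintype.card B)⁻¹ * Complex.exp
          (∑ l, Complex.I * (((a : ℕ) : ℂ) - ((b : ℕ) : ℂ)) * (φ l : ℂ) *
            ∏ j ∈ S l, (((y j : Fin 2) : ℕ) : ℂ)) := by
      rw [hψ]
      simp only [map_mul, Complex.conj_ofReal, ← Complex.exp_conj, Complex.conj_I]
      rw [mul_mul_mul_comm, hnorm, ← Complex.exp_add]
      push_cast
      simp_rw [mul_assoc (Complex.I * (((a : ℕ) : ℂ) - ((b : ℕ) : ℂ)))]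
      rw [← Finset.mul_sum]
      ring_nf
    rw [hρ, Matrix.of_apply]
    simp_rw [hterm]
    rw [← Finset.mul_sum, sum_exp_disjoint_phases S hdisj]
    field_simp
  ext a b
  rw [hentry]
  fin_cases a <;> fin_cases b <;> simp
end

section
/- Let n_A, n_B ≥ 1 and let Γ_A be a real symmetric n_A × n_A matrix and Γ_{AB} a real n_A × n_B matrix, and Γ_B a real symmetric n_B × n_B matrix; let Γ be the symmetric (n_A+n_B) × (n_A+n_B) block matrix with diagonal blocks Γ_A, Γ_B and off-diagonal blocks Γ_{AB}, Γ_{AB}ᵀ. Define the weighted graph state ψ(s) = 2^{−(n_A+n_B)/2}·exp(i·sᵀΓs) for s ∈ {0,1}^{n_A+n_B}. Then for all s_A, s'_A ∈ {0,1}^{n_A}, the entry of the reduced state ρ_A(s_A,s'_A) = Σ_{t ∈ {0,1}^{n_B}} ψ(s_A,t)·conj(ψ(s'_A,t)) equals 2^{−(n_A+n_B)}·exp(i·(s_AᵀΓ_A s_A − s'_AᵀΓ_A s'_A))·Π_{i=1}^{n_B}(1 + exp(2i·(Γ_{AB}ᵀ(s_A − s'_A))_i)). In particular the reduced state of a weighted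 graph state can be evaluated entrywise in closed product form. -/
open Matrix


/-- The quadratic form of a symmetric block matrix, split along the blocks. -/
lemma Matrix.sumElim_dotProduct_fromBlocks_mulVec {R m n : Type*} [CommRing R] [Fintype m]
    [Fintype n] (A : Matrix m m R) (B : Matrix m n R) (D : Matrix n n R) (x : m → R) (y : n → R) :
    Sum.elim x y ⬝ᵥ (fromBlocks A B Bᵀ D).mulVec (Sum.elim x y) =
      x ⬝ᵥ A.mulVec x + 2 * (y ⬝ᵥ Bᵀ.mulVec x) + y ⬝ᵥ D.mulVec y := by
  have h : x ⬝ᵥ B.mulVec y = y ⬝ᵥ Bᵀ.mulVec x := by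
    rw [dotProduct_mulVec, ← mulVec_transpose, dotProduct_comm]
  simp only [fromBlocks_mulVec, sumElim_dotProduct_sumElim, dotProduct_add, Sum.elim_comp_inl,
    Sum.elim_comp_inr, h]
  ring

/-- Summing the characters `t ↦ exp (t ⬝ᵥ c)` over bit strings `t` gives a product. -/
lemma sum_bits_exp_dotProduct {ι : Type*} [Fintype ι] [DecidableEq ι] (c : ι → ℂ) :
    ∑ t : ι → Fin 2, Complex.exp ((fun i => ((t i : ℕ) : ℂ)) ⬝ᵥ c) =
      ∏ i, (1 + Complex.exp (c i)) := by
  have h (i : ι) : 1 + Complex.exp (c i) = ∑ b : Fin 2, Complex.exp (((b : ℕ) : ℂ) * c i) := by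
    simp [Fin.sum_univ_two]
  simp only [h, Finset.prod_univ_sum, Fintype.piFinset_univ, dotProduct, Complex.exp_sum]

/-- The product of one scaled phase with the conjugate of another. -/
lemma scaled_phase_mul_conj (N : ℕ) (a b : ℝ) :
    (((Real.sqrt (2 ^ N))⁻¹ : ℝ) : ℂ) * Complex.exp (Complex.I * (a : ℂ)) *
      (starRingEnd ℂ) ((((Real.sqrt (2 ^ N))⁻¹ : ℝ) : ℂ) * Complex.exp (Complex.I * (b : ℂ))) =
      ((2 : ℂ) ^ N)⁻¹ * Complex.exp (Complex.I * ((a - b : ℝ) : ℂ)) := by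
  have h : (((Real.sqrt (2 ^ N))⁻¹ : ℝ) : ℂ) * (((Real.sqrt (2 ^ N))⁻¹ : ℝ) : ℂ) =
      ((2 : ℂ) ^ N)⁻¹ := by
    rw [← Complex.ofReal_mul, ← mul_inv, Real.mul_self_sqrt (by positivity)]
    push_cast
    rfl
  rw [map_mul, Complex.conj_ofReal, ← Complex.exp_conj, map_mul, Complex.conj_I,
    Complex.conj_ofReal, mul_mul_mul_comm, h, ← Complex.exp_add]
  congr 2
  push_cast
  ring

/-- Closed product form for the entries of the reduced state of a
weighted graph state with adjacency matrix `Γ = fromBlocks Γ_A Γ_AB Γ_ABᵀ Γ_B`. -/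
theorem reduced_state_weighted_graph_state
    (nA nB : ℕ) (hA : 1 ≤ nA) (hB : 1 ≤ nB)
    (ΓA : Matrix (Fin nA) (Fin nA) ℝ) (hΓA : ΓA.IsSymm)
    (ΓB : Matrix (Fin nB) (Fin nB) ℝ) (hΓB : ΓB.IsSymm)
    (ΓAB : Matrix (Fin nA) (Fin nB) ℝ)
    (Γ : Matrix (Fin nA ⊕ Fin nB) (Fin nA ⊕ Fin nB) ℝ)
    (hΓ : Γ = Matrix.fromBlocks ΓA ΓAB ΓABᵀ ΓB)
    (ψ : (Fin nA → Fin 2) × (Fin nB → Fin 2) → ℂ)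
    (hψ : ψ = fun p =>
      (((Real.sqrt (2 ^ (nA + nB)))⁻¹ : ℝ) : ℂ) *
        Complex.exp (Complex.I *
          ((Sum.elim (fun i => ((p.1 i : ℕ) : ℝ)) (fun i => ((p.2 i : ℕ) : ℝ)) ⬝ᵥ
            Γ.mulVec (Sum.elim (fun i => ((p.1 i : ℕ) : ℝ)) (fun i => ((p.2 i : ℕ) : ℝ))) : ℝ) : ℂ)))
    (ρA : Matrix (Fin nA → Fin 2) (Fin nA → Fin 2) ℂ)
    (hρ : ρA = Matrix.of fun sA sA' =>
      ∑ t : Fin nB → Fin 2, ψ (sA, t) * (starRingEnd ℂ) (ψ (sA', t))) :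
    ∀ sA sA' : Fin nA → Fin 2,
      ρA sA sA' = ((2 : ℂ) ^ (nA + nB))⁻¹ *
        Complex.exp (Complex.I *
          ((((fun i => ((sA i : ℕ) : ℝ)) ⬝ᵥ ΓA.mulVec (fun i => ((sA i : ℕ) : ℝ))) -
            ((fun i => ((sA' i : ℕ) : ℝ)) ⬝ᵥ ΓA.mulVec (fun i => ((sA' i : ℕ) : ℝ))) : ℝ) : ℂ)) *
        ∏ i : Fin nB,
          (1 + Complex.exp (2 * Complex.I *
            ((ΓABᵀ.mulVec (fun j => ((sA j : ℕ) : ℝ) - ((sA' j : ℕ) : ℝ)) i : ℝ) : ℂ))) := by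
  intro sA sA'
  subst hρ hψ hΓ
  simp only [Matrix.of_apply, scaled_phase_mul_conj, sumElim_dotProduct_fromBlocks_mulVec]
  rw [← sum_bits_exp_dotProduct, Finset.mul_sum]
  refine Finset.sum_congr rfl fun t _ => ?_
  rw [mul_assoc, ← Complex.exp_add]
  congr 2
  have hsub : (fun j => ((sA j : ℕ) : ℝ) - ((sA' j : ℕ) : ℝ)) =
      (fun j => ((sA j : ℕ) : ℝ)) - fun j => ((sA' j : ℕ) : ℝ) := rfl
  have hcross : (fun i => ((t i : ℕ) : ℂ)) ⬝ᵥ (fun i => 2 * Complex.I *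
      ((ΓABᵀ.mulVec (fun j => ((sA j : ℕ) : ℝ) - ((sA' j : ℕ) : ℝ)) i : ℝ) : ℂ)) =
      2 * Complex.I * (((fun i => ((t i : ℕ) : ℝ)) ⬝ᵥ
        ΓABᵀ.mulVec (fun j => ((sA j : ℕ) : ℝ) - ((sA' j : ℕ) : ℝ)) : ℝ) : ℂ) := by
    simp only [dotProduct, Complex.ofReal_sum, Complex.ofReal_mul, Complex.ofReal_natCast,
      Finset.mul_sum]
    exact Finset.sum_congr rfl fun i _ => by ring
  rw [hcross, hsub, mulVec_sub, dotProduct_sub]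
  push_cast
  ring
end

section
/- Let S be a finite type of N_S system qubits and B a finite type of bath qubits. For each l ∈ S fix a single subset I_l ⊆ B with |I_l| = n_l and a phase φ_l ∈ ℝ, and fix M ⊆ B with |M| = m such that M ⊆ I_l for all l and I_l ∩ I_{l'} = M whenever l ≠ l'. Let U be the diagonal unitary on (S → Fin 2) × (B → Fin 2) whose diagonal entry at (s,k) is exp(i·Σ_{l∈S} φ_l·(s l)·Π_{i∈I_l}(k i)), and E(ρ) = tr_B( U (ρ ⊗ Q_B) Uᴴ ). Then E(ρ) = (1 − 2^{−m})·ρ + 2^{−m}·Σ_{T ⊆ S} (Π_{l∈T} 2^{m−n_l})·(Π_{l∉T} (1 − 2^{m−n_l}))·V_T ρ V_Tᴴ, where V_T is the tensor product applying u(φ_l) on each qubit l ∈ T and the identity on each l ∉ T, i.e., V_T(s,s') = Π_{l∈T}(u(φ_l))_{s l, s' l}·Π_{l∉T} δ_{s l, s' l}. Equivalently, E = (1 − 2^{−m})·id + 2^{−m}·(E_1 ⊗ ⋯ ⊗ E_{N_S}) with E_l(σ) = (1 − 2^{m−n_l})σ + 2^{m−n_l}·u(φ_l) σ u(φ_l)ᴴ.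 -/
open Matrix
open scoped Kronecker

noncomputable section

/-- The number of bit strings that equal `1` on all of `J`. -/
lemma sum_ite_forall_mem_eq_one {B : Type*} [Fintype B] [DecidableEq B] (J : Finset B) :
    ∑ b : B → Fin 2, (if ∀ i ∈ J, b i = 1 then (1 : ℂ) else 0) =
      (2 : ℂ) ^ Fintype.card B * ((2 : ℂ) ^ J.card)⁻¹ := by
  have h : ∀ b : B → Fin 2, (if ∀ i ∈ J, b i = 1 then (1 : ℂ) else 0) =
      ∏ i, (if i ∈ J then (if b i = 1 then (1 : ℂ) else 0) else 1) := by
    intro b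
    simp [Finset.prod_ite_mem, Finset.prod_ite_zero]
  have hswap := Finset.prod_univ_sum (fun _ : B => (Finset.univ : Finset (Fin 2)))
    (fun i j => if i ∈ J then (if j = 1 then (1 : ℂ) else 0) else 1)
  rw [Fintype.piFinset_univ] at hswap
  rw [Finset.sum_congr rfl fun b _ => h b, ← hswap]
  have hi : ∀ i, ∑ j : Fin 2, (if i ∈ J then (if j = 1 then (1 : ℂ) else 0) else 1) =
      2 * (if i ∈ J then (2 : ℂ)⁻¹ else 1) := by
    intro i
    by_cases hiJ : i ∈ J <;> simp [hiJ]
  rw [Finset.prod_congr rfl fun i _ => hi i, Finset.prod_mul_distrib, Finset.prod_ite_mem]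
  simp

/-- Cardinality of a nonempty union of sets pairwise meeting in a common core `M`. -/
lemma card_biUnion_of_common_core {S B : Type*} [DecidableEq B] {I : S → Finset B}
    {M : Finset B} (hsub : ∀ l, M ⊆ I l) (hint : ∀ l l', l ≠ l' → I l ∩ I l' = M)
    {T : Finset S} (hT : T.Nonempty) :
    (T.biUnion I).card = M.card + ∑ l ∈ T, ((I l).card - M.card) := by
  have hunion : T.biUnion I = M ∪ T.biUnion fun l => I l \ M := by
    obtain ⟨l₀, hl₀⟩ := hT
    ext i
    simp only [Finset.mem_biUnion, Finset.mem_union, Finset.mem_sdiff]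
    constructor
    · rintro ⟨l, hl, hi⟩
      by_cases hM : i ∈ M
      · exact Or.inl hM
      · exact Or.inr ⟨l, hl, hi, hM⟩
    · rintro (hM | ⟨l, hl, hi, -⟩)
      · exact ⟨l₀, hl₀, hsub l₀ hM⟩
      · exact ⟨l, hl, hi⟩
  rw [hunion, Finset.card_union_of_disjoint, Finset.card_biUnion]
  · simp only [Finset.card_sdiff_of_subset (hsub _)]
  · intro l _ l' _ hne
    refine Finset.disjoint_left.2 ?_
    intro i hi hi'
    rw [Finset.mem_sdiff] at hi hi'
    exact hi.2 (hint l l' hne ▸ Finset.mem_inter.2 ⟨hi.1, hi'.1⟩)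
  · rw [Finset.disjoint_left]
    intro i hi hi'
    obtain ⟨l, -, hl⟩ := Finset.mem_biUnion.1 hi'
    exact (Finset.mem_sdiff.1 hl).2 hi

/-- The average over bath bit strings of a product of conditional factors, for conditions
supported on sets pairwise meeting in a common core `M`. -/
lemma sum_prod_ite_of_common_core {S B : Type*} [Fintype S] [DecidableEq S]
    [Fintype B] [DecidableEq B] {I : S → Finset B} {M : Finset B}
    (hsub : ∀ l, M ⊆ I l) (hint : ∀ l l', l ≠ l' → I l ∩ I l' = M) (a : S → ℂ) :
    ((2 : ℂ) ^ Fintype.card B)⁻¹ *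
        ∑ b : B → Fin 2, ∏ l, (if ∀ i ∈ I l, b i = 1 then a l else 1) =
      (1 - ((2 : ℂ) ^ M.card)⁻¹) + ((2 : ℂ) ^ M.card)⁻¹ *
        ∏ l, ((2 : ℂ) ^ ((M.card : ℤ) - ((I l).card : ℤ)) * a l +
          (1 - (2 : ℂ) ^ ((M.card : ℤ) - ((I l).card : ℤ)))) := by
  have hp : ∀ l, (2 : ℂ) ^ ((M.card : ℤ) - ((I l).card : ℤ)) =
      ((2 : ℂ) ^ ((I l).card - M.card))⁻¹ := by
    intro l
    rw [← zpow_natCast, ← _root_.zpow_neg, Nat.cast_sub (Finset.card_le_card (hsub l)), neg_sub]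
  have hterm : ∀ b : B → Fin 2, ∏ l, (if ∀ i ∈ I l, b i = 1 then a l else 1) =
      ∑ T : Finset S, (∏ l ∈ T, (a l - 1)) *
        (if ∀ i ∈ T.biUnion I, b i = 1 then (1 : ℂ) else 0) := by
    intro b
    have h : ∀ l, (if ∀ i ∈ I l, b i = 1 then a l else 1) =
        (a l - 1) * (if ∀ i ∈ I l, b i = 1 then (1 : ℂ) else 0) + 1 := by
      intro l
      split_ifs <;> simp
    rw [Finset.prod_congr rfl fun l _ => h l, Finset.prod_add_one, Finset.powerset_univ]
    refine Finset.sum_congr rfl fun T _ => ?_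
    rw [Finset.prod_mul_distrib, Finset.prod_ite_zero, Finset.prod_const_one]
    congr 2
    simp only [Finset.mem_biUnion, eq_iff_iff]
    exact ⟨fun h i ⟨l, hl, hi⟩ => h l hl i hi, fun h l hl i hi => h i ⟨l, hl, hi⟩⟩
  have hfac : ∀ l, (2 : ℂ) ^ ((M.card : ℤ) - ((I l).card : ℤ)) * a l +
      (1 - (2 : ℂ) ^ ((M.card : ℤ) - ((I l).card : ℤ))) =
      (a l - 1) * ((2 : ℂ) ^ ((I l).card - M.card))⁻¹ + 1 := by
    intro l
    rw [hp]
    ring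
  have hB : (2 : ℂ) ^ Fintype.card B ≠ 0 := pow_ne_zero _ two_ne_zero
  rw [Finset.sum_congr rfl fun b _ => hterm b, Finset.sum_comm,
    Finset.prod_congr rfl fun l _ => hfac l, Finset.prod_add_one, Finset.powerset_univ,
    Finset.mul_sum, Finset.mul_sum,
    ← Finset.add_sum_erase _ _ (Finset.mem_univ (∅ : Finset S)),
    ← Finset.add_sum_erase Finset.univ
      (fun T : Finset S => ((2 : ℂ) ^ M.card)⁻¹ * _) (Finset.mem_univ (∅ : Finset S)),
    ← add_assoc]
  congr 1
  · simp
  · refine Finset.sum_congr rfl fun T hT => ?_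
    rw [← Finset.mul_sum, sum_ite_forall_mem_eq_one, card_biUnion_of_common_core hsub hint
      (Finset.nonempty_iff_ne_empty.2 (Finset.ne_of_mem_erase hT)), Finset.prod_mul_distrib,
      Finset.prod_inv_distrib, Finset.prod_pow_eq_pow_sum, pow_add]
    field_simp

/-- The diagonal entries of the phase gate. -/
def phaseGateEntry (θ : ℝ) (j : Fin 2) : ℂ :=
  if j = 1 then Complex.exp (Complex.I * (θ : ℂ)) else 1

/-- Acting with phase gates on the qubits in `T` gives a diagonal matrix. -/
lemma prod_phaseGate_mul_prod_ite {S : Type*} [Fintype S] [DecidableEq S]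
    (φ : S → ℝ) (T : Finset S) :
    (Matrix.of fun s s' : S → Fin 2 =>
      (∏ l ∈ T, (phaseGate (φ l)) (s l) (s' l)) *
        ∏ l ∈ Tᶜ, (if s l = s' l then (1 : ℂ) else 0)) =
      Matrix.diagonal fun s => ∏ l ∈ T, phaseGateEntry (φ l) (s l) := by
  ext s s'
  by_cases h : s = s'
  · subst h
    simp [phaseGate, phaseGateEntry]
  · rw [Matrix.diagonal_apply_ne _ h, Matrix.of_apply]
    obtain ⟨l, hl⟩ := Function.ne_iff.1 h
    by_cases hT : l ∈ T
    · rw [Finset.prod_eq_zero hT (by rw [phaseGate, Matrix.diagonal_apply_ne _ hl]), zero_mul]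
    · rw [Finset.prod_eq_zero (Finset.mem_compl.2 hT) (if_neg hl), mul_zero]

/-- The interaction phase factors over the system qubits. -/
lemma exp_interaction_eq_prod {S B : Type*} [Fintype S] (I : S → Finset B) (φ : S → ℝ)
    (s : S → Fin 2) (b : B → Fin 2) :
    Complex.exp (Complex.I *
        ((∑ l, φ l * ((s l : ℕ) : ℝ) * ∏ i ∈ I l, ((b i : ℕ) : ℝ) : ℝ) : ℂ)) =
      ∏ l, (if ∀ i ∈ I l, b i = 1 then phaseGateEntry (φ l) (s l) else 1) := by
  have hbit : ∀ j : Fin 2, ((j : ℕ) : ℝ) = if j = 1 then 1 else 0 := by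
    intro j
    fin_cases j <;> simp
  rw [Complex.ofReal_sum, Finset.mul_sum, Complex.exp_sum]
  refine Finset.prod_congr rfl fun l _ => ?_
  simp only [hbit, Finset.prod_ite_zero, Finset.prod_const_one, phaseGateEntry]
  split_ifs <;> simp

/-- Each system qubit `l` interacts via a single pure phase gate with
phase `φ_l` on a set `I_l` of `n_l` bath qubits; a fixed set `M` of `m` bath qubits
satisfies `M ⊆ I_l` and `I_l ∩ I_{l'} = M` for `l ≠ l'`. Then
`E(ρ) = (1 - 2^{-m}) ρ + 2^{-m} Σ_{T ⊆ S} (Π_{l∈T} 2^{m-n_l}) (Π_{l∉T} (1-2^{m-n_l}))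
V_T ρ V_Tᴴ`, where `V_T` applies `u(φ_l)` on the qubits `l ∈ T` and the identity on the
others. -/
theorem common_bath_single_gate_map
    {S B : Type*} [Fintype S] [DecidableEq S] [Fintype B] [DecidableEq B]
    (I : S → Finset B) (φ : S → ℝ) (M : Finset B)
    (hsub : ∀ l, M ⊆ I l)
    (hint : ∀ l l', l ≠ l' → I l ∩ I l' = M)
    (U : Matrix ((S → Fin 2) × (B → Fin 2)) ((S → Fin 2) × (B → Fin 2)) ℂ)
    (hU : U = Matrix.diagonal fun p =>
      Complex.exp (Complex.I *
        ((∑ l, φ l * ((p.1 l : ℕ) : ℝ) * ∏ i ∈ I l, ((p.2 i : ℕ) : ℝ) : ℝ) : ℂ)))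
    (Q : Matrix (B → Fin 2) (B → Fin 2) ℂ)
    (hQ : Q = Matrix.of fun _ _ => ((2 : ℂ) ^ Fintype.card B)⁻¹)
    (E : Matrix (S → Fin 2) (S → Fin 2) ℂ → Matrix (S → Fin 2) (S → Fin 2) ℂ)
    (hE : ∀ ρ, E ρ = Matrix.of fun s s' =>
      ∑ b : B → Fin 2, (U * (ρ ⊗ₖ Q) * Uᴴ) (s, b) (s', b))
    (V : Finset S → Matrix (S → Fin 2) (S → Fin 2) ℂ)
    (hV : ∀ T, V T = Matrix.of fun s s' =>
      (∏ l ∈ T, (phaseGate (φ l)) (s l) (s' l)) *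
        ∏ l ∈ Tᶜ, (if s l = s' l then (1 : ℂ) else 0)) :
    ∀ ρ : Matrix (S → Fin 2) (S → Fin 2) ℂ,
      E ρ = (1 - ((2 : ℂ) ^ M.card)⁻¹) • ρ + ((2 : ℂ) ^ M.card)⁻¹ •
        ∑ T : Finset S,
          ((∏ l ∈ T, (2 : ℂ) ^ ((M.card : ℤ) - ((I l).card : ℤ))) *
            ∏ l ∈ Tᶜ, (1 - (2 : ℂ) ^ ((M.card : ℤ) - ((I l).card : ℤ)))) •
            (V T * ρ * (V T)ᴴ) := by
  intro ρ
  ext s s'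
  have hVT : ∀ T, (V T * ρ * (V T)ᴴ) s s' =
      (∏ l ∈ T, phaseGateEntry (φ l) (s l) * star (phaseGateEntry (φ l) (s' l))) * ρ s s' := by
    intro T
    rw [hV, prod_phaseGate_mul_prod_ite, Matrix.diagonal_conjTranspose, Matrix.mul_diagonal,
      Matrix.diagonal_mul, Finset.prod_mul_distrib, Pi.star_apply, star_prod]
    ring
  have hUb : ∀ b, (U * (ρ ⊗ₖ Q) * Uᴴ) (s, b) (s', b) =
      ((2 : ℂ) ^ Fintype.card B)⁻¹ * (∏ l, (if ∀ i ∈ I l, b i = 1 then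
        phaseGateEntry (φ l) (s l) * star (phaseGateEntry (φ l) (s' l)) else 1)) * ρ s s' := by
    intro b
    have hsplit : ∀ l, (if ∀ i ∈ I l, b i = 1 then
        phaseGateEntry (φ l) (s l) * star (phaseGateEntry (φ l) (s' l)) else 1) =
        (if ∀ i ∈ I l, b i = 1 then phaseGateEntry (φ l) (s l) else 1) *
          star (if ∀ i ∈ I l, b i = 1 then phaseGateEntry (φ l) (s' l) else 1) := by
      intro l
      split_ifs <;> simp
    rw [hU, hQ, Matrix.diagonal_conjTranspose, Matrix.mul_diagonal, Matrix.diagonal_mul,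
      Pi.star_apply, exp_interaction_eq_prod, exp_interaction_eq_prod,
      Matrix.kroneckerMap_apply, Matrix.of_apply, star_prod,
      Finset.prod_congr rfl fun l _ => hsplit l, Finset.prod_mul_distrib]
    ring_nf
  rw [hE, Matrix.of_apply, Finset.sum_congr rfl fun b _ => hUb b, ← Finset.sum_mul,
    ← Finset.mul_sum, sum_prod_ite_of_common_core hsub hint, Fintype.prod_add]
  simp only [Matrix.add_apply, Matrix.smul_apply, Matrix.sum_apply, smul_eq_mul, hVT]
  rw [add_mul, mul_assoc, Finset.sum_mul]
  congr 2
  refine Finset.sum_congr rfl fun T _ => ?_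
  rw [Finset.prod_mul_distrib]
  ring

end
end

section
/- Fix n ≥ 1, k ≥ 1 and phases φ_1,…,φ_k ∈ ℝ, and let Φ = Σ_{i=1}^{k} φ_i. For each i let U(φ_i) be the pure phase gate of order n+1 with phase φ_i acting on one system qubit together with the same n bath qubits, i.e., the diagonal unitary on Fin 2 × (Fin n → Fin 2) multiplying a basis vector by e^{iφ_i} exactly when all n+1 bits equal 1. Then (i) Π_{i=1}^{k} U(φ_i) = U(Φ), the pure phase gate of order n+1 with phase Φ; and (ii) the extreme non-Markovian reduced dynamics E(σ) = tr_B( (Π_i U(φ_i)) (σ ⊗ Q) (Π_i U(φ_i))ᴴ ) satisfies E(σ)(0,1) = ((2^n − 1 + e^{−iΦ})/2^n)·σ(0,1), E(σ)(1,0) = ((2^n − 1 + e^{iΦ})/2^n)·σ(1,0), and E(σ)(i,i) = σ(i,i); so the coherence is multiplied by the single factor |(2^n − 1 + e^{−iΣφ_i})/2^n| depending only on the sum of the phases. -/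
open Matrix
open scoped Kronecker

theorem prod_ofFn_eq_of_map_add {M : Type*} [Monoid M] {A : Type*} [AddCommMonoid A]
    (f : A → M) (h0 : f 0 = 1) (hadd : ∀ a b, f (a + b) = f a * f b) {k : ℕ} (φ : Fin k → A) :
    (List.ofFn fun i => f (φ i)).prod = f (∑ i, φ i) := by
  induction k with
  | zero => simp [h0]
  | succ k ih => rw [List.ofFn_succ, List.prod_cons, ih, Fin.sum_univ_succ, hadd]

theorem sum_ite_forall_eq_one (n : ℕ) (x : ℂ) :
    ∑ b : Fin n → Fin 2, (if ∀ j, b j = 1 then x else 1) = (2 : ℂ) ^ n - 1 + x := by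
  have h : ∀ b : Fin n → Fin 2, (if ∀ j, b j = 1 then x else 1)
      = 1 + if b = fun _ => 1 then x - 1 else 0 := by
    intro b
    simp only [funext_iff]
    split_ifs <;> ring
  rw [Finset.sum_congr rfl fun b _ => h b, Finset.sum_add_distrib]
  simp
  ring

/-- Conjugating a Kronecker product by a diagonal matrix acts entrywise. -/
theorem diagonal_mul_kronecker_mul_conjTranspose_apply {m l : Type*} [Fintype m] [Fintype l]
    [DecidableEq m] [DecidableEq l] (d : m × l → ℂ) (A : Matrix m m ℂ) (B : Matrix l l ℂ)
    (s s' : m) (b b' : l) :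
    (Matrix.diagonal d * (A ⊗ₖ B) * (Matrix.diagonal d)ᴴ) (s, b) (s', b')
      = d (s, b) * star (d (s', b')) * B b b' * A s s' := by
  rw [Matrix.diagonal_conjTranspose, Matrix.mul_diagonal, Matrix.diagonal_mul,
    Matrix.kronecker_apply, Pi.star_apply]
  ring

/-- Extreme non-Markovian scenario: `k` pure phase gates of order `n+1`
acting on the same `n` bath qubits compose to a single pure phase gate whose phase is the
sum of the phases, and the resulting reduced dynamics multiplies the coherence by
`(2^n - 1 + e^{-iΣφ_i})/2^n` while leaving the populations unchanged. -/
theorem extreme_non_markovian_phase_sum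
    (n k : ℕ) (hn : 1 ≤ n) (hk : 1 ≤ k) (φ : Fin k → ℝ)
    (U : ℝ → Matrix (Fin 2 × (Fin n → Fin 2)) (Fin 2 × (Fin n → Fin 2)) ℂ)
    (hU : ∀ θ : ℝ, U θ = Matrix.diagonal fun p =>
      if p.1 = 1 ∧ (∀ j, p.2 j = 1) then Complex.exp (Complex.I * (θ : ℂ)) else 1)
    (Q : Matrix (Fin n → Fin 2) (Fin n → Fin 2) ℂ)
    (hQ : Q = Matrix.of fun _ _ => ((2 : ℂ) ^ n)⁻¹)
    (E : Matrix (Fin 2) (Fin 2) ℂ → Matrix (Fin 2) (Fin 2) ℂ)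
    (hE : ∀ σ, E σ = Matrix.of fun (s s' : Fin 2) => ∑ b : Fin n → Fin 2,
      ((List.ofFn fun i => U (φ i)).prod * (σ ⊗ₖ Q) *
        ((List.ofFn fun i => U (φ i)).prod)ᴴ) (s, b) (s', b)) :
    (List.ofFn fun i => U (φ i)).prod = U (∑ i, φ i) ∧
    ∀ σ : Matrix (Fin 2) (Fin 2) ℂ,
      E σ 0 1 = (((2 : ℂ) ^ n - 1 + Complex.exp (-(Complex.I * ((∑ i, φ i : ℝ) : ℂ)))) / (2 : ℂ) ^ n) * σ 0 1
        ∧ E σ 1 0 = (((2 : ℂ) ^ n - 1 + Complex.exp (Complex.I * ((∑ i, φ i : ℝ) : ℂ))) / (2 : ℂ) ^ n) * σ 1 0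
        ∧ ∀ j : Fin 2, E σ j j = σ j j := by
  have hprod : (List.ofFn fun i => U (φ i)).prod = U (∑ i, φ i) := by
    refine prod_ofFn_eq_of_map_add U ?_ (fun a b => ?_) φ
    · simp [hU]
    · rw [hU, hU, hU, Matrix.diagonal_mul_diagonal]
      congr 1
      funext p
      split_ifs
      · rw [Complex.ofReal_add, mul_add, Complex.exp_add]
      · rw [mul_one]
  refine ⟨hprod, fun σ => ?_⟩
  have h2 : (2 : ℂ) ^ n ≠ 0 := pow_ne_zero _ two_ne_zero
  set Φ : ℝ := ∑ i, φ i
  have hentry : ∀ s s', E σ s s' = (∑ b : Fin n → Fin 2,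
      (if s = 1 ∧ (∀ j, b j = 1) then Complex.exp (Complex.I * (Φ : ℂ)) else 1) *
        star (if s' = 1 ∧ (∀ j, b j = 1) then Complex.exp (Complex.I * (Φ : ℂ)) else 1)) /
          (2 : ℂ) ^ n * σ s s' := by
    intro s s'
    rw [hE, hprod, hU, hQ, div_eq_mul_inv, Finset.sum_mul, Finset.sum_mul, Matrix.of_apply]
    exact Finset.sum_congr rfl fun b _ =>
      diagonal_mul_kronecker_mul_conjTranspose_apply _ _ _ _ _ _ _
  have hstar : star (Complex.exp (Complex.I * (Φ : ℂ))) = Complex.exp (-(Complex.I * (Φ : ℂ))) := by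
    rw [Complex.star_def, ← Complex.exp_conj]
    simp
  have hunit : Complex.exp (Complex.I * (Φ : ℂ)) * star (Complex.exp (Complex.I * (Φ : ℂ))) = 1 := by
    rw [hstar, ← Complex.exp_add, add_neg_cancel, Complex.exp_zero]
  refine ⟨?_, ?_, fun j => ?_⟩
  · rw [hentry, ← sum_ite_forall_eq_one, ← hstar]
    simp [apply_ite (star : ℂ → ℂ), -Complex.star_def, -RCLike.star_def]
  · rw [hentry, ← sum_ite_forall_eq_one]
    simp
  · have hone : ∀ b : Fin n → Fin 2,
        (if j = 1 ∧ (∀ i, b i = 1) then Complex.exp (Complex.I * (Φ : ℂ)) else 1) *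
        star (if j = 1 ∧ (∀ i, b i = 1) then Complex.exp (Complex.I * (Φ : ℂ)) else 1) = 1 := by
      intro b
      split_ifs
      · exact hunit
      · simp
    rw [hentry, Finset.sum_congr rfl fun b _ => hone b]
    simp [h2]
end

section
/- For every n ≥ 1 and every function α : (Fin n → Fin 2) → ℝ, there exists a function φ : Finset (Fin n) → ℝ such that for every bit string x : Fin n → Fin 2, α(x) = Σ_{S ∈ Finset.univ.powerset} φ(S) · Π_{j∈S} (x j : ℝ) (bits regarded as 0/1 reals, empty product equal to 1). Consequently, every n-qubit phase gate (diagonal unitary with diagonal entries e^{iα(x)}) can be written as a product of pure phase gates: the phase gate with phases φ(∅) (a global phase), the single-qubit gates with phases φ({j}), the two-qubit gates with phases φ({j,k}), and so on up to the n-qubit pure phase gate with phase φ(Fin n). Hence any locally maximally entangleable state D|+⟩^{⊗n} can be prepared hierarchically by generalized Ising (multi-qubit phase-gate) interactions applied to |+⟩^{⊗n}. -/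
/-- The Kronecker delta of two bit strings, as a polynomial in the bits `x j` with coefficients
depending on `y`. -/
theorem prod_bit_interpolation {ι : Type*} [Fintype ι] [DecidableEq ι] (x y : ι → Fin 2) :
    ∏ j, ((2 * ((y j : ℕ) : ℝ) - 1) * ((x j : ℕ) : ℝ) + (1 - ((y j : ℕ) : ℝ))) =
      if y = x then 1 else 0 := by
  have key : ∀ a b : Fin 2,
      (2 * ((b : ℕ) : ℝ) - 1) * ((a : ℕ) : ℝ) + (1 - ((b : ℕ) : ℝ)) = if b = a then 1 else 0 := by
    intro a b
    fin_cases a <;> fin_cases b <;> norm_num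
  simp only [key, Finset.prod_boole, Finset.mem_univ, true_imp_iff, funext_iff]


/-- Every real phase function `α` on `n`-bit strings can be expanded as
`α(x) = Σ_{S ⊆ {1,…,n}} φ(S) · Π_{j∈S} x_j` (bits as 0/1 reals); hence every `n`-qubit
phase gate is a product of pure phase gates and every LME state can be prepared
hierarchically by generalized Ising interactions. -/
theorem phase_function_pure_phase_decomposition
    (n : ℕ) (hn : 1 ≤ n) (α : (Fin n → Fin 2) → ℝ) :
    ∃ φ : Finset (Fin n) → ℝ, ∀ x : Fin n → Fin 2,
      α x = ∑ T ∈ (Finset.univ : Finset (Fin n)).powerset,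
        φ T * ∏ j ∈ T, ((x j : ℕ) : ℝ) := by
  refine ⟨fun T => ∑ y, α y * ((∏ j ∈ T, (2 * ((y j : ℕ) : ℝ) - 1)) *
    ∏ j ∈ Finset.univ \ T, (1 - ((y j : ℕ) : ℝ))), fun x => ?_⟩
  calc α x = ∑ y, α y *
        ∏ j, ((2 * ((y j : ℕ) : ℝ) - 1) * ((x j : ℕ) : ℝ) + (1 - ((y j : ℕ) : ℝ))) := by
        simp [prod_bit_interpolation]
    _ = _ := by
        simp only [Finset.prod_add, Finset.prod_mul_distrib, Finset.mul_sum, Finset.sum_mul]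
        rw [Finset.sum_comm]
        refine Finset.sum_congr rfl fun T _ => Finset.sum_congr rfl fun y _ => ?_
        ring
end

section
/- For every natural number N with N ≥ 2, the real inequality ((10 + 6·cos(π/N))/16)^{N/2} > 1/2 holds (the exponent N/2 taken as a real power). In the paper's setting this is the claim that for the N-qubit GHZ-type input state √p|0…0⟩ + √(1−p)|1…1⟩ (0 < p < 1) subjected to pure three-qubit phase gates with phase φ = π/N on each system qubit, the coherence factor |((3 + e^{iπ/N})/4)^{N}|^{1/2} = ((10+6cos(π/N))/16)^{N/4} arising when each system qubit couples to its own independent bath exceeds the factor |(3 + e^{iNφ})/4|^{1/2} = (1/2)^{1/2} arising when all system qubits couple to the same (fully correlated) bath; hence the log-negativity across the one-versus-rest bipartition satisfies E_indep > E_dep, so a correlated bath can destroy entanglement faster than independent baths, for every number N ≥ 2 of system qubits. -/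
/-- For every `N ≥ 2`, `((10 + 6 cos(π/N))/16)^(N/2) > 1/2` (real power).
This expresses that the coherence factor of the GHZ-type state under independent baths
exceeds the one for a fully correlated bath, so `E_indep > E_dep`. -/
theorem independent_bath_coherence_gt
    (N : ℕ) (hN : 2 ≤ N) :
    (1 / 2 : ℝ) < ((10 + 6 * Real.cos (Real.pi / N)) / 16) ^ ((N : ℝ) / 2) := by
  have hN2 : (2 : ℝ) ≤ N := by exact_mod_cast hN
  have hpi : Real.pi ^ 2 < 10 := by nlinarith [Real.pi_lt_d2, Real.pi_pos]
  have hcos : 1 - (Real.pi / N) ^ 2 / 2 ≤ Real.cos (Real.pi / N) :=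
    Real.one_sub_sq_div_two_le_cos
  have hquad : (N : ℝ) * (Real.pi / N) ^ 2 < 5 := by
    have : (N : ℝ) * (Real.pi / N) ^ 2 = Real.pi ^ 2 / N := by field_simp
    rw [this, div_lt_iff₀ (by linarith)]
    linarith
  have hbernoulli := one_add_mul_self_le_rpow_one_add
    (s := (10 + 6 * Real.cos (Real.pi / N)) / 16 - 1) (p := (N : ℝ) / 2)
    (by linarith [Real.neg_one_le_cos (Real.pi / N)]) (by linarith)
  rw [add_sub_cancel] at hbernoulli
  have hmul := mul_le_mul_of_nonneg_left hcos (Nat.cast_nonneg (α := ℝ) N)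
  linarith
end
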